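/- K-way LCP-merge with an LCP-aware tournament tree, merging K sorted sequences of strings S_1,…,S_K (with LCP arrays H_1,…,H_K, all sharing a common prefix, K a power of two) into the sorted output S_0 with LCP array H_0, performs at most ΔL + n·log₂ K + K character comparisons, where n = |S_0| is the total number of strings and ΔL = L(H_0) − Σ_{k=1}^K L(H_k) is the total increment of LCP array entries. -/

import Mathlib

/-- The length of the longest common prefix of two lists. -/
def lcp {α : Type*} [DecidableEq α] : List α → List α → ℕ
  | a :: s, b :: t => if a = b then lcp s t + 1 else 0
  | _, _ => 0

/-- Sum of the entries of the LCP array of a sequence of strings: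
`lcpSum ⟨s₁,…,s_n⟩ = L(H) = Σ_{i=2}^n lcp s_{i-1} s_i`. -/
def lcpSum {α : Type*} [DecidableEq α] : List (List α) → ℕ
  | s :: t :: rest => lcp s t + lcpSum (t :: rest)
  | _ => 0

/-- Annotate each string of a sequence, starting from predecessor `p`, with the
LCP to its predecessor. -/
def annotateFrom {α : Type*} [DecidableEq α] (p : List α) :
    List (List α) → List (List α × ℕ)
  | [] => []
  | s :: rest => (s, lcp p s) :: annotateFrom s rest

/-- Annotate each string of a sorted sequence with its LCP array: each string is
paired with the LCP to its predecessor. -/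
def annotate {α : Type*} [DecidableEq α] : List (List α) → List (List α × ℕ)
  | [] => []
  | s :: rest => (s, 0) :: annotateFrom s rest

/-- Binary LCP-merge with character-comparison counting (one game of the LCP-aware
tournament): the two front strings `a`, `b` with stored LCPs `ha`, `hb` relative to a
common smaller predecessor are compared by binary LCP-compare: if `ha ≠ hb`, the
string with the larger LCP wins without character comparisons; if `ha = hb`,
characters from position `ha + 1` onward are compared (`m` matches plus the final
mismatching ternary comparison, i.e. `m + 1` character comparisons) and the loser's
stored LCP is updated to `lcp a b`. -/
def lcpMergeC {α : Type*} [LinearOrder α] :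
    List (List α × ℕ) → List (List α × ℕ) → List (List α × ℕ) × ℕ
  | [], ys => (ys, 0)
  | xs, [] => (xs, 0)
  | (a, ha) :: xs, (b, hb) :: ys =>
    if ha = hb then
      let m := lcp (a.drop ha) (b.drop ha)
      if a ≤ b then
        let r := lcpMergeC xs ((b, ha + m) :: ys)
        ((a, ha) :: r.1, r.2 + m + 1)
      else
        let r := lcpMergeC ((a, ha + m) :: xs) ys
        ((b, hb) :: r.1, r.2 + m + 1)
    else if hb < ha then
      let r := lcpMergeC xs ((b, hb) :: ys)
      ((a, ha) :: r.1, r.2)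
    else
      let r := lcpMergeC ((a, ha) :: xs) ys
      ((b, hb) :: r.1, r.2)
termination_by xs ys => xs.length + ys.length

/-- `K`-way LCP-merge with an LCP-aware tournament tree over `K` annotated input
streams (for `K` a power of two, the tournament is the perfect binary tree over the
streams): each selection of the next output string plays LCP-aware games along the
path to the root, reusing the LCP values stored in the tree.  Returns the merged
annotated sequence and the total number of character comparisons. -/
def kwayMergeC {α : Type*} [LinearOrder α] :
    List (List (List α × ℕ)) → List (List α × ℕ) × ℕ
  | [] => ([], 0)
  | [s] => (s, 0)
  | S₁ :: S₂ :: rest =>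
    let r₁ := kwayMergeC ((S₁ :: S₂ :: rest).take ((S₁ :: S₂ :: rest).length / 2))
    let r₂ := kwayMergeC ((S₁ :: S₂ :: rest).drop ((S₁ :: S₂ :: rest).length / 2))
    let m := lcpMergeC r₁.1 r₂.1
    (m.1, r₁.2 + r₂.2 + m.2)
termination_by l => l.length
decreasing_by
  · simp [List.length_take]; omega
  · simp; omega

section helpers
variable {α : Type*} [LinearOrder α]

theorem lcp_nil_left (s : List α) : lcp [] s = 0 := by cases s <;> simp [lcp]

theorem lcp_nil_right (s : List α) : lcp s [] = 0 := by cases s <;> simp [lcp]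

theorem lcp_symm (s t : List α) : lcp s t = lcp t s := by
  induction s generalizing t with
  | nil => rw [lcp_nil_left, lcp_nil_right]
  | cons a s ih =>
    cases t with
    | nil => rw [lcp_nil_left, lcp_nil_right]
    | cons b t => simp only [lcp, ih t, eq_comm]

theorem nil_le_aux (s : List α) : [] ≤ s := by
  rw [← not_lt]
  exact List.not_lt_nil s

theorem cons_le_aux (x y : α) (s t : List α) :
    x :: s ≤ y :: t ↔ x < y ∨ x = y ∧ s ≤ t := by
  rw [← not_lt, ← not_lt (b := s), List.cons_lt_cons_iff]
  rcases lt_trichotomy x y with h | h | h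
  · simp [h, h.not_gt, h.ne']
  · simp [h]
  · simp [h, h.not_gt, h.ne']

theorem lcp_lt_aux (p a b : List α) (hpa : p ≤ a) (hpb : p ≤ b)
    (h : lcp p b < lcp p a) : a ≤ b ∧ lcp a b = lcp p b := by
  induction p generalizing a b with
  | nil => simp [lcp_nil_left] at h
  | cons x p ih =>
    cases a with
    | nil => simp [lcp_nil_right] at h
    | cons y a =>
      cases b with
      | nil => exact absurd (List.nil_lt_cons x p) (not_lt.mpr hpb)
      | cons z b =>
        rw [cons_le_aux] at hpa hpb ⊢
        simp only [lcp] at h ⊢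
        by_cases hxy : x = y
        · subst hxy
          by_cases hxz : x = z
          · subst hxz
            simp only [lt_irrefl, false_or, true_and, if_true] at *
            obtain ⟨h1, h2⟩ := ih a b hpa hpb (by omega)
            exact ⟨h1, by omega⟩
          · simp only [if_neg hxz, and_true]
            left
            rcases hpb with h' | h'
            · exact h'
            · exact absurd h'.1 hxz
        · simp [hxy] at h

theorem lcp_drop_aux (p a b : List α) (h : lcp p a = lcp p b) :
    lcp p a + lcp (a.drop (lcp p a)) (b.drop (lcp p a)) = lcp a b := by
  induction p generalizing a b with
  | nil => simp [lcp_nil_left]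
  | cons x p ih =>
    cases a with
    | nil => simp [lcp_nil_right, lcp_nil_left]
    | cons y a =>
      cases b with
      | nil => rw [h]; simp [lcp_nil_right]
      | cons z b =>
        by_cases hxy : x = y
        · subst hxy
          by_cases hxz : x = z
          · subst hxz
            simp only [lcp, if_true] at h ⊢
            have := ih a b (by omega)
            simp only [List.drop_succ_cons]
            omega
          · simp [lcp, hxz] at h
        · have h0 : lcp (x :: p) (y :: a) = 0 := by simp [lcp, hxy]
          rw [h0]; simp

theorem lcpSum_cons_cons (p s : List α) (S : List (List α)) :
    lcpSum (p :: s :: S) = lcp p s + lcpSum (s :: S) := by simp [lcpSum]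

theorem lcpSum_nil_cons (S : List (List α)) : lcpSum ([] :: S) = lcpSum S := by
  cases S with
  | nil => simp [lcpSum]
  | cons s S => rw [lcpSum_cons_cons, lcp_nil_left, Nat.zero_add]

theorem annotate_eq (S : List (List α)) : annotate S = annotateFrom [] S := by
  cases S with
  | nil => rfl
  | cons s S => simp [annotate, annotateFrom, lcp_nil_left]

theorem annotateFrom_fst (p : List α) (S : List (List α)) :
    (annotateFrom p S).map Prod.fst = S := by
  induction S generalizing p with
  | nil => rfl
  | cons s S ih => simp [annotateFrom, ih]

theorem merge_aux (n : ℕ) (p : List α) (xs ys : List (List α))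
    (hn : xs.length + ys.length = n)
    (hx : (p :: xs).Pairwise (· ≤ ·)) (hy : (p :: ys).Pairwise (· ≤ ·)) :
    ∃ zs : List (List α),
      (lcpMergeC (annotateFrom p xs) (annotateFrom p ys)).1 = annotateFrom p zs ∧
      zs.Perm (xs ++ ys) ∧ zs.Pairwise (· ≤ ·) ∧
      (lcpMergeC (annotateFrom p xs) (annotateFrom p ys)).2 +
        lcpSum (p :: xs) + lcpSum (p :: ys) ≤ lcpSum (p :: zs) + n := by
  induction n generalizing p xs ys with
  | zero =>
    have h1 : xs = [] := List.length_eq_zero_iff.mp (by omega)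
    have h2 : ys = [] := List.length_eq_zero_iff.mp (by omega)
    subst h1 h2
    exact ⟨[], by simp [annotateFrom, lcpMergeC, lcpSum]⟩
  | succ n ih =>
    cases xs with
    | nil =>
      refine ⟨ys, ?_, by simp, hy.of_cons, ?_⟩ <;> simp [annotateFrom, lcpMergeC, lcpSum]
    | cons a xs =>
    cases ys with
    | nil =>
      refine ⟨a :: xs, ?_, by simp, hx.of_cons, ?_⟩ <;>
        simp [annotateFrom, lcpMergeC, lcpSum]
    | cons b ys =>
      have hpa : p ≤ a := List.rel_of_pairwise_cons hx (by simp)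
      have hpb : p ≤ b := List.rel_of_pairwise_cons hy (by simp)
      have hx' := hx.of_cons
      have hy' := hy.of_cons
      simp only [List.length_cons] at hn
      -- the two possible recursive calls
      have goA : ∀ hab : a ≤ b, _ := fun hab =>
        ih a xs (b :: ys) (by simp only [List.length_cons]; omega) hx'
          (List.pairwise_cons.mpr ⟨fun z hz => by
            rcases List.mem_cons.mp hz with rfl | hz
            · exact hab
            · exact hab.trans (List.rel_of_pairwise_cons hy' hz), hy'⟩)
      have goB : ∀ hba : b ≤ a, _ := fun hba =>
        ih b (a :: xs) ys (by simp only [List.length_cons]; omega)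
          (List.pairwise_cons.mpr ⟨fun z hz => by
            rcases List.mem_cons.mp hz with rfl | hz
            · exact hba
            · exact hba.trans (List.rel_of_pairwise_cons hx' hz), hx'⟩) hy'
      have sortA : a ≤ b → ∀ zs : List (List α), zs.Perm (xs ++ b :: ys) →
          zs.Pairwise (· ≤ ·) → (a :: zs).Pairwise (· ≤ ·) := by
        intro hab zs hp hs
        refine List.pairwise_cons.mpr ⟨fun z hz => ?_, hs⟩
        rcases List.mem_append.mp (hp.mem_iff.mp hz) with hz | hz
        · exact List.rel_of_pairwise_cons hx' hz
        · rcases List.mem_cons.mp hz with rfl | hz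
          · exact hab
          · exact hab.trans (List.rel_of_pairwise_cons hy' hz)
      have sortB : b ≤ a → ∀ zs : List (List α), zs.Perm (a :: xs ++ ys) →
          zs.Pairwise (· ≤ ·) → (b :: zs).Pairwise (· ≤ ·) := by
        intro hba zs hp hs
        refine List.pairwise_cons.mpr ⟨fun z hz => ?_, hs⟩
        rcases List.mem_append.mp (hp.mem_iff.mp hz) with hz | hz
        · rcases List.mem_cons.mp hz with rfl | hz
          · exact hba
          · exact hba.trans (List.rel_of_pairwise_cons hx' hz)
        · exact List.rel_of_pairwise_cons hy' hz
      have permB : ∀ zs : List (List α), zs.Perm (a :: xs ++ ys) →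
          (b :: zs).Perm (a :: xs ++ b :: ys) := fun zs hp =>
        (hp.cons b).trans List.perm_middle.symm
      simp only [annotateFrom] at goA goB ⊢
      rw [lcpMergeC]
      by_cases heq : lcp p a = lcp p b
      · have hd := lcp_drop_aux p a b heq
        by_cases hab : a ≤ b
        · obtain ⟨zs, h1, h2, h3, h4⟩ := goA hab
          refine ⟨a :: zs, ?_, h2.cons a, sortA hab zs h2 h3, ?_⟩
          · simp only [heq, hab, if_true, annotateFrom]
            rw [heq] at hd
            rw [hd, h1]
          · simp only [heq, hab, if_true]
            rw [heq] at hd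
            rw [hd]
            simp only [lcpSum_cons_cons] at h4 ⊢
            omega
        · have hba : b ≤ a := le_of_not_ge hab
          obtain ⟨zs, h1, h2, h3, h4⟩ := goB hba
          rw [lcp_symm b a] at h1 h4
          refine ⟨b :: zs, ?_, permB zs h2, sortB hba zs h2 h3, ?_⟩
          · simp only [heq, hab, if_true, if_false, annotateFrom]
            rw [heq] at hd
            rw [hd, h1]
          · simp only [heq, hab, if_true, if_false]
            rw [heq] at hd
            rw [hd]
            simp only [lcpSum_cons_cons, lcp_symm b a] at h4 ⊢
            omega
      · by_cases hlt : lcp p b < lcp p a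
        · obtain ⟨hab, hl⟩ := lcp_lt_aux p a b hpa hpb hlt
          obtain ⟨zs, h1, h2, h3, h4⟩ := goA hab
          rw [hl] at h1 h4
          refine ⟨a :: zs, ?_, h2.cons a, sortA hab zs h2 h3, ?_⟩
          · simp only [heq, hlt, if_true, if_false, annotateFrom]
            rw [h1]
          · simp only [heq, hlt, if_true, if_false]
            simp only [lcpSum_cons_cons, hl] at h4 ⊢
            omega
        · obtain ⟨hba, hl⟩ := lcp_lt_aux p b a hpb hpa (by omega)
          obtain ⟨zs, h1, h2, h3, h4⟩ := goB hba
          rw [hl] at h1 h4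
          refine ⟨b :: zs, ?_, permB zs h2, sortB hba zs h2 h3, ?_⟩
          · simp only [heq, hlt, if_false, annotateFrom]
            rw [h1]
          · simp only [heq, hlt, if_false]
            simp only [lcpSum_cons_cons, hl] at h4 ⊢
            omega

theorem kway_aux (d : ℕ) (SS : List (List (List α)))
    (hK : SS.length = 2 ^ d)
    (hsorted : ∀ S ∈ SS, S.Pairwise (· ≤ ·)) :
    ∃ zs : List (List α),
      (kwayMergeC (SS.map annotate)).1 = annotateFrom [] zs ∧
      zs.length = (SS.map List.length).sum ∧ zs.Pairwise (· ≤ ·) ∧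
      (kwayMergeC (SS.map annotate)).2 + (SS.map lcpSum).sum ≤
        lcpSum zs + (SS.map List.length).sum * d := by
  induction d generalizing SS with
  | zero =>
    obtain ⟨S, rfl⟩ := List.length_eq_one_iff.mp (by simpa using hK)
    exact ⟨S, by simp [kwayMergeC, annotate_eq], by simp, hsorted S (by simp),
      by simp [kwayMergeC]⟩
  | succ d ih =>
    have hpos : 0 < 2 ^ d := by positivity
    have hlen : SS.length / 2 = 2 ^ d := by rw [hK, pow_succ]; omega
    have hk : kwayMergeC (SS.map annotate) =
        ((lcpMergeC (kwayMergeC ((SS.take (2 ^ d)).map annotate)).1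
            (kwayMergeC ((SS.drop (2 ^ d)).map annotate)).1).1,
          (kwayMergeC ((SS.take (2 ^ d)).map annotate)).2 +
          (kwayMergeC ((SS.drop (2 ^ d)).map annotate)).2 +
          (lcpMergeC (kwayMergeC ((SS.take (2 ^ d)).map annotate)).1
            (kwayMergeC ((SS.drop (2 ^ d)).map annotate)).1).2) := by
      rw [← hlen]
      match SS, hK with
      | [], h => rw [pow_succ, List.length_nil] at h; omega
      | [_], h => rw [pow_succ] at h; simp at h; omega
      | S₁ :: S₂ :: rest, _ =>
        rw [List.map_cons, List.map_cons, kwayMergeC]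
        simp only [List.map_take, List.map_drop, List.map_cons, List.length_cons,
          List.length_map]
    rw [hk]
    obtain ⟨z1, a1, l1, s1, c1⟩ := ih (SS.take (2 ^ d))
      (by rw [List.length_take, hK, pow_succ]; omega)
      (fun S hS => hsorted S (List.mem_of_mem_take hS))
    obtain ⟨z2, a2, l2, s2, c2⟩ := ih (SS.drop (2 ^ d))
      (by rw [List.length_drop, hK, pow_succ]; omega)
      (fun S hS => hsorted S (List.mem_of_mem_drop hS))
    have e1 : (SS.map lcpSum).sum =
        ((SS.take (2 ^ d)).map lcpSum).sum + ((SS.drop (2 ^ d)).map lcpSum).sum := by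
      rw [← List.sum_append, ← List.map_append, List.take_append_drop]
    have e2 : (SS.map List.length).sum =
        ((SS.take (2 ^ d)).map List.length).sum +
          ((SS.drop (2 ^ d)).map List.length).sum := by
      rw [← List.sum_append, ← List.map_append, List.take_append_drop]
    obtain ⟨zs, h1, h2, h3, h4⟩ := merge_aux _ [] z1 z2 rfl
      (List.pairwise_cons.mpr ⟨fun z _ => nil_le_aux z, s1⟩)
      (List.pairwise_cons.mpr ⟨fun z _ => nil_le_aux z, s2⟩)
    simp only [lcpSum_nil_cons] at h4
    refine ⟨zs, ?_, ?_, h3, ?_⟩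
    · simp only [a1, a2, h1]
    · rw [h2.length_eq, List.length_append, l1, l2, e2]
    · simp only [a1, a2]
      rw [e1, e2]
      rw [l1, l2] at h4
      generalize ((SS.take (2 ^ d)).map List.length).sum = n1 at *
      generalize ((SS.drop (2 ^ d)).map List.length).sum = n2 at *
      have : (n1 + n2) * (d + 1) = n1 * d + n2 * d + (n1 + n2) := by ring
      omega

end helpers

/-- `K`-way LCP-merge of `K = 2^d` sorted sequences `S₁, …, S_K` (with their LCP
arrays, all strings sharing a common prefix `P`) into the sorted output `S₀` with LCP
array `H₀` performs at most `ΔL + n·log₂ K + K` character comparisons, where `n` is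
the total number of strings and `ΔL = L(H₀) − Σ_k L(H_k)` is the total increment of
LCP array entries (stated additively to avoid truncated subtraction). -/
theorem kwayMergeC_comparisons {α : Type*} [LinearOrder α]
    (d : ℕ) (SS : List (List (List α)))
    (hK : SS.length = 2 ^ d)
    (hsorted : ∀ S ∈ SS, S.Pairwise (· ≤ ·))
    (P : List α) (hP : ∀ S ∈ SS, ∀ s ∈ S, P <+: s) :
    (kwayMergeC (SS.map annotate)).2 + (SS.map lcpSum).sum ≤
      lcpSum ((kwayMergeC (SS.map annotate)).1.map Prod.fst) +
        (SS.map List.length).sum * d + 2 ^ d := by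
  obtain ⟨zs, h1, _, _, h4⟩ := kway_aux d SS hK hsorted
  rw [h1, annotateFrom_fst]
  omega
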